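/- arXiv:2211.09604 — 7 statements merged into one kernel-verified Lean document; each statement's English description precedes it below -/
import Mathlib

section
/- Consider a CKSVAR(k) in p variables: real sequences y_t ∈ ℝ and x_t ∈ ℝ^{p−1} (for t ≥ −k+1), with y_t⁺ := max(y_t,0) and y_t⁻ := min(y_t,0), satisfying for all t ≥ 1 the structural equation φ₀⁺y_t⁺ + φ₀⁻y_t⁻ + Φ₀ˣx_t = c + Σ_{i=1}^k (φ_i⁺ y_{t−i}⁺ + φ_i⁻ y_{t−i}⁻ + Φ_iˣ x_{t−i}) + u_t. Assume Φ₀,ₓₓ (the lower (p−1)×(p−1) block of Φ₀ˣ) is invertible and that φ̃₀,yy^± := φ₀,yy^± − φ₀,yxᵀ Φ₀,ₓₓ^{-1} φ₀,xy^± > 0 for both signs. Define ỹ_t⁺ := φ̃₀,yy⁺ y_t⁺, ỹ_t⁻ := φ̃₀,yy⁻ y_t⁻, x̃_t := φ₀,xy⁺ y_t⁺ + φ₀,xy⁻ y_t⁻ + Φ₀,ₓₓ x_t, and ỹ_t := ỹ_t⁺ + ỹ_t⁻. Then: (a) ỹ_t⁺ = max(ỹ_t,0) and ỹ_t⁻ =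 min(ỹ_t,0) for all t; and (b) with Q := [[1, −φ₀,yxᵀΦ₀,ₓₓ^{-1}],[0, I_{p−1}]] and P the inverse of the block matrix with rows (φ̃₀,yy⁺,0,0), (0,φ̃₀,yy⁻,0), (φ₀,xy⁺,φ₀,xy⁻,Φ₀,ₓₓ), the transformed sequences (ỹ_t, x̃_t) satisfy for all t ≥ 1 the equation φ̃₀⁺ỹ_t⁺ + φ̃₀⁻ỹ_t⁻ + Φ̃₀ˣx̃_t = Qc + Σ_{i=1}^k (φ̃_i⁺ ỹ_{t−i}⁺ + φ̃_i⁻ ỹ_{t−i}⁻ + Φ̃_iˣ x̃_{t−i}) + Qu_t, where [φ̃⁺(λ), φ̃⁻(λ), Φ̃ˣ(λ)] := Q[φ⁺(λ), φ⁻(λ), Φˣ(λ)]P, and this transformed system is canonical: [φ̃₀⁺, φ̃₀⁻, Φ̃₀ˣ] = [[1,1,0],[0,0,I_{p−1}]]. -/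
open Matrix

namespace CKSVAR

/-- `p`-dimensional coordinate index: the `y` coordinate (`inl`) plus the `p − 1 = px`
`x`-coordinates (`inr`). -/
abbrev Iv (px : ℕ) := Unit ⊕ Fin px

/-- `(p+1)`-dimensional index: `y⁺`, `y⁻`, and the `x`-coordinates. -/
abbrev Kv (px : ℕ) := Unit ⊕ (Unit ⊕ Fin px)

/-- Stack the `p × (p+1)` coefficient matrix `[a, b, M]` from the two `y`-columns
`a, b` and the `p × (p−1)` block `M`. -/
def stack {px : ℕ} (a b : Iv px → ℝ) (M : Matrix (Iv px) (Fin px) ℝ) :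
    Matrix (Iv px) (Kv px) ℝ :=
  Matrix.of fun i => Sum.elim (fun _ => a i) (Sum.elim (fun _ => b i) (fun j => M i j))

/-- The vector `(max y 0, min y 0, x)` of `y⁺`, `y⁻` and `x`. -/
def pmVec {px : ℕ} (y : ℝ) (x : Fin px → ℝ) : Kv px → ℝ :=
  Sum.elim (fun _ => max y 0) (Sum.elim (fun _ => min y 0) x)

/-- The canonical contemporaneous coefficient matrix `[[1,1,0],[0,0,I_{p−1}]]`. -/
def Ican (px : ℕ) : Matrix (Iv px) (Kv px) ℝ :=
  Matrix.of fun i j =>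
    match i, j with
    | Sum.inl _, Sum.inl _ => 1
    | Sum.inl _, Sum.inr (Sum.inl _) => 1
    | Sum.inl _, Sum.inr (Sum.inr _) => 0
    | Sum.inr _, Sum.inl _ => 0
    | Sum.inr _, Sum.inr (Sum.inl _) => 0
    | Sum.inr i', Sum.inr (Sum.inr j') => if i' = j' then 1 else 0

/-- The block matrix with rows `(a, 0, 0)`, `(0, b, 0)`, `(v, w, M)`. -/
def blockTransform {px : ℕ} (a b : ℝ) (v w : Fin px → ℝ) (M : Matrix (Fin px) (Fin px) ℝ) :
    Matrix (Kv px) (Kv px) ℝ :=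
  fromBlocks (of fun _ _ => a) 0 (of fun i _ => Sum.elim (fun _ => 0) v i)
    (fromBlocks (of fun _ _ => b) 0 (of fun i _ => w i) M)

lemma isUnit_det_blockTransform {px : ℕ} {a b : ℝ} (v w : Fin px → ℝ)
    {M : Matrix (Fin px) (Fin px) ℝ} (ha : a ≠ 0) (hb : b ≠ 0) (hM : IsUnit M) :
    IsUnit (blockTransform a b v w M).det := by
  have hdet : M.det ≠ 0 := ((isUnit_iff_isUnit_det M).1 hM).ne_zero
  simp [blockTransform, det_fromBlocks_zero₁₂, ha, hb, hdet]

lemma blockTransform_mulVec_pmVec {px : ℕ} (a b : ℝ) (v w : Fin px → ℝ)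
    (M : Matrix (Fin px) (Fin px) ℝ) (y : ℝ) (x : Fin px → ℝ) :
    blockTransform a b v w M *ᵥ pmVec y x =
      Sum.elim (fun _ => a * max y 0) (Sum.elim (fun _ => b * min y 0)
        fun j => v j * max y 0 + w j * min y 0 + (M *ᵥ x) j) := by
  ext (i | i | i) <;>
    simp [blockTransform, pmVec, mulVec, dotProduct, Fintype.sum_sum_type, add_assoc]

lemma Ican_mul_blockTransform {px : ℕ} (a b : ℝ) (v w : Fin px → ℝ)
    (M : Matrix (Fin px) (Fin px) ℝ) :
    Ican px * blockTransform a b v w M =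
      stack (Sum.elim (fun _ => a) v) (Sum.elim (fun _ => b) w)
        (of (Sum.elim (fun _ => 0) fun i => M i)) := by
  ext (i | i) (j | j | j) <;>
    simp [blockTransform, Ican, stack, mul_apply, Fintype.sum_sum_type]

lemma mul_stack {px : ℕ} (Q : Matrix (Iv px) (Iv px) ℝ) (a b : Iv px → ℝ)
    (M : Matrix (Iv px) (Fin px) ℝ) :
    Q * stack a b M = stack (Q *ᵥ a) (Q *ᵥ b) (Q * M) := by
  ext i (j | j | j) <;> simp [stack, mul_apply, mulVec, dotProduct]

lemma mul_max_zero_eq_max {a b : ℝ} (ha : 0 < a) (hb : 0 < b) (y : ℝ) :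
    a * max y 0 = max (a * max y 0 + b * min y 0) 0 := by
  rcases le_total 0 y with h | h
  · simp [h, mul_nonneg ha.le h]
  · simp [h, mul_nonpos_of_nonneg_of_nonpos hb.le h]

lemma mul_min_zero_eq_min {a b : ℝ} (ha : 0 < a) (hb : 0 < b) (y : ℝ) :
    b * min y 0 = min (a * max y 0 + b * min y 0) 0 := by
  rcases le_total 0 y with h | h
  · simp [h, mul_nonneg ha.le h]
  · simp [h, mul_nonpos_of_nonneg_of_nonpos hb.le h]

/-- Eliminating the `x`-block from the first row by the Schur complement. -/
lemma schur_mul_stack {px : ℕ} (a b : Iv px → ℝ) (M : Matrix (Iv px) (Fin px) ℝ)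
    (D : Matrix (Fin px) (Fin px) ℝ) (r : Fin px → ℝ)
    (hD : D = of fun i j => M (Sum.inr i) j) (hr : r = fun j => M (Sum.inl ()) j)
    (hinv : IsUnit D) :
    (fromBlocks 1 (of fun _ j => -(r ᵥ* D⁻¹) j) 0 1 : Matrix (Iv px) (Iv px) ℝ) * stack a b M =
      stack
        (Sum.elim (fun _ => a (Sum.inl ()) - r ⬝ᵥ D⁻¹ *ᵥ fun i => a (Sum.inr i))
          fun i => a (Sum.inr i))
        (Sum.elim (fun _ => b (Sum.inl ()) - r ⬝ᵥ D⁻¹ *ᵥ fun i => b (Sum.inr i))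
          fun i => b (Sum.inr i))
        (of (Sum.elim (fun _ => 0) fun i => D i)) := by
  have hcancel : (r ᵥ* D⁻¹) ᵥ* D = r := by
    rw [vecMul_vecMul, nonsing_inv_mul _ ((isUnit_iff_isUnit_det D).1 hinv), vecMul_one]
  have hcol (z : Iv px → ℝ) :
      (fromBlocks 1 (of fun _ j => -(r ᵥ* D⁻¹) j) 0 1 : Matrix (Iv px) (Iv px) ℝ) *ᵥ z =
        Sum.elim (fun _ => z (Sum.inl ()) - r ⬝ᵥ D⁻¹ *ᵥ fun i => z (Sum.inr i))
          fun i => z (Sum.inr i) := by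
    ext (i | i)
    · rw [dotProduct_mulVec]
      simp [mulVec, dotProduct, Fintype.sum_sum_type, sub_eq_add_neg]
    · simp [mulVec, dotProduct, Fintype.sum_sum_type, one_apply]
  rw [mul_stack, hcol, hcol]
  congr 1
  ext i j
  change (_ *ᵥ fun l => M l j) i = _
  rw [hcol]
  rcases i with i | i
  · have h : (r ᵥ* D⁻¹) ⬝ᵥ (fun i => M (Sum.inr i) j) = r j := by
      conv_rhs => rw [← hcancel]
      simp only [hD, vecMul, of_apply]
    simp only [Sum.elim_inl, of_apply]
    rw [dotProduct_mulVec, h, hr, sub_self, Pi.zero_apply]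
  · simp [hD]

/-- reduction of a CKSVAR to its canonical form.
Given a CKSVAR(k) in `p = px + 1` variables satisfying the coherency conditions
(`Φ₀,ₓₓ` invertible, `φ̃₀,yy^± > 0`), the transformed variables
`ỹ_t⁺ := φ̃₀,yy⁺ y_t⁺`, `ỹ_t⁻ := φ̃₀,yy⁻ y_t⁻`,
`x̃_t := φ₀,xy⁺ y_t⁺ + φ₀,xy⁻ y_t⁻ + Φ₀,ₓₓ x_t`, `ỹ_t := ỹ_t⁺ + ỹ_t⁻` satisfy:
(a) `ỹ_t⁺ = max(ỹ_t,0)` and `ỹ_t⁻ = min(ỹ_t,0)`; and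
(b) the transformed coefficients `[φ̃_i⁺, φ̃_i⁻, Φ̃_iˣ] = Q [φ_i⁺, φ_i⁻, Φ_iˣ] P` satisfy the
CKSVAR equation in the tilde variables and are canonical at lag `0`. -/
theorem canonical_transformation {px : ℕ} (hpx : 1 ≤ px)
    (k : ℕ) (hk : 1 ≤ k)
    (φp φm : ℕ → Iv px → ℝ) (Φx : ℕ → Matrix (Iv px) (Fin px) ℝ)
    (c : Iv px → ℝ) (u : ℤ → Iv px → ℝ)
    (y : ℤ → ℝ) (x : ℤ → Fin px → ℝ)
    -- partition of the contemporaneous coefficient matrix Φ₀ = [φ₀⁺, φ₀⁻, Φ₀ˣ]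
    (Φ0xx : Matrix (Fin px) (Fin px) ℝ)
    (hΦ0xx : Φ0xx = Matrix.of fun i j => Φx 0 (Sum.inr i) j)
    (φ0yx : Fin px → ℝ) (hφ0yx : φ0yx = fun j => Φx 0 (Sum.inl ()) j)
    (φ0xyp φ0xym : Fin px → ℝ)
    (hφ0xyp : φ0xyp = fun i => φp 0 (Sum.inr i))
    (hφ0xym : φ0xym = fun i => φm 0 (Sum.inr i))
    (hinv : IsUnit Φ0xx)
    (tφp tφm : ℝ)
    (htφp : tφp = φp 0 (Sum.inl ()) - φ0yx ⬝ᵥ Φ0xx⁻¹.mulVec φ0xyp)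
    (htφm : tφm = φm 0 (Sum.inl ()) - φ0yx ⬝ᵥ Φ0xx⁻¹.mulVec φ0xym)
    (htφp_pos : 0 < tφp) (htφm_pos : 0 < tφm)
    -- the structural CKSVAR equation (with threshold b = 0)
    (hmodel : ∀ t : ℤ, 1 ≤ t →
      (stack (φp 0) (φm 0) (Φx 0)).mulVec (pmVec (y t) (x t))
        = c + ∑ i ∈ Finset.Icc 1 k,
            (stack (φp i) (φm i) (Φx i)).mulVec (pmVec (y (t - (i : ℤ))) (x (t - (i : ℤ))))
          + u t)
    -- the matrices Q and P (P is the inverse of the displayed block matrix)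
    (Q : Matrix (Iv px) (Iv px) ℝ)
    (hQ : Q = Matrix.fromBlocks 1 (Matrix.of fun _ j => -(Matrix.vecMul φ0yx Φ0xx⁻¹ j)) 0 1)
    (Pinv : Matrix (Kv px) (Kv px) ℝ)
    (hPinv : Pinv = Matrix.of fun i j =>
      match i, j with
      | Sum.inl _, Sum.inl _ => tφp
      | Sum.inl _, _ => 0
      | Sum.inr (Sum.inl _), Sum.inr (Sum.inl _) => tφm
      | Sum.inr (Sum.inl _), _ => 0
      | Sum.inr (Sum.inr i'), Sum.inl _ => φ0xyp i'
      | Sum.inr (Sum.inr i'), Sum.inr (Sum.inl _) => φ0xym i'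
      | Sum.inr (Sum.inr i'), Sum.inr (Sum.inr j') => Φ0xx i' j')
    -- the canonical variables
    (ty : ℤ → ℝ) (tx : ℤ → Fin px → ℝ)
    (hty : ∀ t, ty t = tφp * max (y t) 0 + tφm * min (y t) 0)
    (htx : ∀ t, tx t = fun j =>
      φ0xyp j * max (y t) 0 + φ0xym j * min (y t) 0 + Φ0xx.mulVec (x t) j)
    -- the transformed coefficient matrices [φ̃_i⁺, φ̃_i⁻, Φ̃_iˣ] := Q [φ_i⁺, φ_i⁻, Φ_iˣ] P
    (Mt : ℕ → Matrix (Iv px) (Kv px) ℝ)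
    (hMt : ∀ i, Mt i = Q * stack (φp i) (φm i) (Φx i) * Pinv⁻¹) :
    -- (a): the transformed positive/negative parts are the positive/negative parts of ỹ
    (∀ t : ℤ, tφp * max (y t) 0 = max (ty t) 0 ∧ tφm * min (y t) 0 = min (ty t) 0) ∧
    -- (b): the transformed system is a canonical CKSVAR
    Mt 0 = Ican px ∧
    (∀ t : ℤ, 1 ≤ t →
      (Mt 0).mulVec (pmVec (ty t) (tx t))
        = Q.mulVec c + ∑ i ∈ Finset.Icc 1 k,
            (Mt i).mulVec (pmVec (ty (t - (i : ℤ))) (tx (t - (i : ℤ))))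
          + Q.mulVec (u t)) := by
  have hP : Pinv = blockTransform tφp tφm φ0xyp φ0xym Φ0xx := by
    rw [hPinv]
    ext (i | i | i) (j | j | j) <;> rfl
  have hunit : IsUnit Pinv.det :=
    hP ▸ isUnit_det_blockTransform φ0xyp φ0xym htφp_pos.ne' htφm_pos.ne' hinv
  have hparts (t : ℤ) : tφp * max (y t) 0 = max (ty t) 0 ∧ tφm * min (y t) 0 = min (ty t) 0 := by
    rw [hty]
    exact ⟨mul_max_zero_eq_max htφp_pos htφm_pos _, mul_min_zero_eq_min htφp_pos htφm_pos _⟩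
  have hvec (t : ℤ) : pmVec (ty t) (tx t) = Pinv *ᵥ pmVec (y t) (x t) := by
    rw [hP, blockTransform_mulVec_pmVec, (hparts t).1, (hparts t).2, htx]
    rfl
  have hterm (i : ℕ) (t : ℤ) : Mt i *ᵥ pmVec (ty t) (tx t) =
      Q *ᵥ (stack (φp i) (φm i) (Φx i) *ᵥ pmVec (y t) (x t)) := by
    rw [hvec, hMt, mulVec_mulVec, nonsing_inv_mul_cancel_right _ _ hunit, mulVec_mulVec]
  refine ⟨hparts, ?_, fun t ht => ?_⟩
  · have hQstack : Q * stack (φp 0) (φm 0) (Φx 0) = Ican px * Pinv := by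
      rw [hQ, schur_mul_stack _ _ _ Φ0xx φ0yx hΦ0xx hφ0yx hinv, hP, Ican_mul_blockTransform,
        htφp, htφm, hφ0xyp, hφ0xym]
    rw [hMt, hQstack, mul_nonsing_inv_cancel_right _ _ hunit]
  · simp only [hterm]
    rw [hmodel t ht, mulVec_add, mulVec_add, mulVec_sum]

end CKSVAR
end

section
/- Consider a canonical CKSVAR(k) with coefficients as in the context, and suppose rank Π⁺ = r with Π⁺ = α⁺β⁺ᵀ, α⁺, β⁺ ∈ ℝ^{p×r} of full column rank. Define: ξ_t⁺ := β⁺ᵀz_t; 𝛏_t⁺ := (ξ_t⁺; Δz_t; …; Δz_{t−k+2}); 𝐲_{t−1}⁻ := (y_{t−1}⁻, …, y_{t−k+1}⁻) ∈ ℝ^{k−1}; for t ≥ 1, ŷ_t := e₁ᵀc + [1 + e₁ᵀ(φ₁⁻ − φ₁⁺)]y_{t−1}⁻ + Σ_{i=2}^k e₁ᵀ(φ_i⁻ − φ_i⁺)y_{t−i}⁻ + 𝐞₁ᵀ𝛂⁺𝛏_{t−1}⁺ + e₁ᵀu_t (where 𝐞₁ is the first standard basis vector of ℝ^{kp} and 𝛂⁺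 is the bold matrix built from α⁺ and Γ_i⁺ as in the context), with ŷ₀ := y₀⁻; δ₀ := 1 and, for t ≥ 1, δ_t := (y_{t−1}⁺ + ŷ_t)/ŷ_t if y_{t−1}⁺ + ŷ_t < 0 and δ_t := 0 otherwise; ζ_t := (𝛏_t⁺; ŷ_t; 𝐲_{t−1}⁻); 𝛍 := (𝛃⁺_{1:p}ᵀc; e₁ᵀc; 0_{k−1}); 𝛆_t := (𝛃⁺_{1:p}ᵀu_t; e₁ᵀu_t; 0_{k−1}). Then for every t ≥ 1: ζ_t = 𝛍 + F_{δ_{t−1}} ζ_{t−1} + 𝛆_t, and y_t⁻ = δ_t ŷ_t, where for δ ∈ [0,1], F_δ is the square matrix of order p(k−1)+r+k with block rows: [I_{p(k−1)+r} + 𝛃⁺ᵀ𝛂⁺, 𝛃⁺_{1:p}ᵀ(φ₁⁻−φ₁⁺)δ, 𝛃⁺_{1:p}ᵀ(φ₂⁻−φ₂⁺, …, φ_k⁻−φ_k⁺)]; [e₁ᵀ𝛂⁺, (1 + e₁ᵀ(φ₁⁻−φ₁⁺))δ, e₁ᵀ(φ₂⁻−φ₂⁺, …, φ_k⁻−φ_k⁺)];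 [0, δ, 0]; [0, 0, D] with D := [I_{k−2}, 0_{(k−2)×1}]. -/
open Matrix

namespace CKSVARCaseI

variable {px : ℕ}

/-- The square coefficient matrix `Φ_i = [φ_i, Φ_iˣ] ∈ ℝ^{p×p}` (with `p = px + 1`),
whose first column is `φ_i` and whose remaining columns are `Φ_iˣ`. -/
def PhiOf (φ : ℕ → Fin (px + 1) → ℝ) (Φx : ℕ → Matrix (Fin (px + 1)) (Fin px) ℝ)
    (i : ℕ) : Matrix (Fin (px + 1)) (Fin (px + 1)) ℝ :=
  Matrix.of fun l => Fin.cons (φ i l) (fun jx => Φx i l jx)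

/-- `Γ_i := −Σ_{j=i+1}^k Φ_j`. -/
noncomputable def Γmat (k : ℕ) (Φ : ℕ → Matrix (Fin (px + 1)) (Fin (px + 1)) ℝ) (i : ℕ) :
    Matrix (Fin (px + 1)) (Fin (px + 1)) ℝ := -(∑ j ∈ Finset.Icc (i + 1) k, Φ j)

/-- The bold matrix `𝛂⁺ ∈ ℝ^{kp×(p(k−1)+r)}` with first block row `[α⁺, Γ₁⁺, …, Γ_{k−1}⁺]`
and, below it, `k−1` block rows placing `I_p` in block column `j+1` of row `j`. -/
noncomputable def boldA (k : ℕ) {r : ℕ} (Φ : ℕ → Matrix (Fin (px + 1)) (Fin (px + 1)) ℝ)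
    (α : Matrix (Fin (px + 1)) (Fin r) ℝ) :
    Matrix (Fin (px + 1) ⊕ Fin (k - 1) × Fin (px + 1))
      (Fin r ⊕ Fin (k - 1) × Fin (px + 1)) ℝ :=
  Matrix.of fun i j =>
    match i, j with
    | Sum.inl l, Sum.inl a => α l a
    | Sum.inl l, Sum.inr mj => Γmat k Φ ((mj.1 : ℕ) + 1) l mj.2
    | Sum.inr _, Sum.inl _ => 0
    | Sum.inr mi, Sum.inr mj => if mi.1 = mj.1 ∧ mi.2 = mj.2 then 1 else 0

/-- The bold matrix `𝛃⁺ᵀ ∈ ℝ^{(p(k−1)+r)×kp}` with first block row `[β⁺ᵀ, 0, …, 0]` and,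
for `m = 1,…,k−1`, a block row with `I_p` in block column `m` and `−I_p` in block
column `m+1`. -/
def boldBT (k : ℕ) {r : ℕ} (β : Matrix (Fin (px + 1)) (Fin r) ℝ) :
    Matrix (Fin r ⊕ Fin (k - 1) × Fin (px + 1))
      (Fin (px + 1) ⊕ Fin (k - 1) × Fin (px + 1)) ℝ :=
  Matrix.of fun i j =>
    match i, j with
    | Sum.inl a, Sum.inl l => β l a
    | Sum.inl _, Sum.inr _ => 0
    | Sum.inr mi, Sum.inl l => if (mi.1 : ℕ) = 0 ∧ mi.2 = l then 1 else 0
    | Sum.inr mi, Sum.inr mj =>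
        if mj.1 = mi.1 ∧ mi.2 = mj.2 then -1
        else if (mj.1 : ℕ) + 1 = (mi.1 : ℕ) ∧ mi.2 = mj.2 then 1 else 0

/-- The level vector `z_t = (y_t, x_t) ∈ ℝ^p`. -/
def zf (y : ℤ → ℝ) (x : ℤ → Fin px → ℝ) (t : ℤ) : Fin (px + 1) → ℝ :=
  Fin.cons (y t) (x t)

/-- The stacked vector `𝛏_t⁺ = (β⁺ᵀz_t; Δz_t; …; Δz_{t−k+2})`. -/
def bxiP (k : ℕ) {r : ℕ} (βp : Matrix (Fin (px + 1)) (Fin r) ℝ)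
    (y : ℤ → ℝ) (x : ℤ → Fin px → ℝ) (t : ℤ) :
    (Fin r ⊕ Fin (k - 1) × Fin (px + 1)) → ℝ :=
  Sum.elim (βpᵀ.mulVec (zf y x t))
    (fun mj => zf y x (t - ((mj.1 : ℕ) : ℤ)) mj.2 - zf y x (t - ((mj.1 : ℕ) : ℤ) - 1) mj.2)

/-- The auxiliary series `ŷ_t` (for `t ≥ 1` given by the display in Lemma statcomp;
`ŷ_t := y_t⁻` for `t ≤ 0`). -/
noncomputable def yhatF (k : ℕ) {r : ℕ} (φp φm : ℕ → Fin (px + 1) → ℝ)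
    (Φx : ℕ → Matrix (Fin (px + 1)) (Fin px) ℝ)
    (αp : Matrix (Fin (px + 1)) (Fin r) ℝ) (βp : Matrix (Fin (px + 1)) (Fin r) ℝ)
    (c : Fin (px + 1) → ℝ)
    (y : ℤ → ℝ) (x : ℤ → Fin px → ℝ) (u : ℤ → Fin (px + 1) → ℝ) (t : ℤ) : ℝ :=
  if 1 ≤ t then
    c 0 + (1 + (φm 1 0 - φp 1 0)) * min (y (t - 1)) 0
      + ∑ i ∈ Finset.Icc 2 k, (φm i 0 - φp i 0) * min (y (t - (i : ℤ))) 0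
      + ∑ col, boldA k (PhiOf φp Φx) αp (Sum.inl 0) col * bxiP k βp y x (t - 1) col
      + u t 0
  else min (y t) 0

/-- The switching variable `δ_t` (`δ₀ := 1`; for `t ≥ 1` as in Lemma statcomp). -/
noncomputable def deltaF (k : ℕ) {r : ℕ} (φp φm : ℕ → Fin (px + 1) → ℝ)
    (Φx : ℕ → Matrix (Fin (px + 1)) (Fin px) ℝ)
    (αp βp : Matrix (Fin (px + 1)) (Fin r) ℝ) (c : Fin (px + 1) → ℝ)
    (y : ℤ → ℝ) (x : ℤ → Fin px → ℝ) (u : ℤ → Fin (px + 1) → ℝ) (t : ℤ) : ℝ :=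
  if 1 ≤ t then
    (if max (y (t - 1)) 0 + yhatF k φp φm Φx αp βp c y x u t < 0 then
      (max (y (t - 1)) 0 + yhatF k φp φm Φx αp βp c y x u t)
        / yhatF k φp φm Φx αp βp c y x u t
    else 0)
  else 1

/-- The companion vector `ζ_t = (𝛏_t⁺; ŷ_t; 𝐲_{t−1}⁻)`. -/
noncomputable def zetaF (k : ℕ) {r : ℕ} (φp φm : ℕ → Fin (px + 1) → ℝ)
    (Φx : ℕ → Matrix (Fin (px + 1)) (Fin px) ℝ)
    (αp βp : Matrix (Fin (px + 1)) (Fin r) ℝ) (c : Fin (px + 1) → ℝ)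
    (y : ℤ → ℝ) (x : ℤ → Fin px → ℝ) (u : ℤ → Fin (px + 1) → ℝ) (t : ℤ) :
    ((Fin r ⊕ Fin (k - 1) × Fin (px + 1)) ⊕ (Unit ⊕ Fin (k - 1))) → ℝ :=
  Sum.elim (bxiP k βp y x t)
    (Sum.elim (fun _ => yhatF k φp φm Φx αp βp c y x u t)
      (fun j => min (y (t - 1 - ((j : ℕ) : ℤ))) 0))

/-- The matrix `F_δ` of Lemma statcomp. -/
noncomputable def Fmat (k : ℕ) {r : ℕ} (φp φm : ℕ → Fin (px + 1) → ℝ)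
    (Φx : ℕ → Matrix (Fin (px + 1)) (Fin px) ℝ)
    (αp βp : Matrix (Fin (px + 1)) (Fin r) ℝ) (δ : ℝ) :
    Matrix ((Fin r ⊕ Fin (k - 1) × Fin (px + 1)) ⊕ (Unit ⊕ Fin (k - 1)))
      ((Fin r ⊕ Fin (k - 1) × Fin (px + 1)) ⊕ (Unit ⊕ Fin (k - 1))) ℝ :=
  Matrix.of fun i j =>
    match i, j with
    | Sum.inl a, Sum.inl b =>
        ((1 : Matrix (Fin r ⊕ Fin (k - 1) × Fin (px + 1))
            (Fin r ⊕ Fin (k - 1) × Fin (px + 1)) ℝ)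
          + boldBT k βp * boldA k (PhiOf φp Φx) αp) a b
    | Sum.inl a, Sum.inr (Sum.inl _) =>
        (∑ i : Fin (px + 1), boldBT k βp a (Sum.inl i) * (φm 1 i - φp 1 i)) * δ
    | Sum.inl a, Sum.inr (Sum.inr jj) =>
        ∑ i : Fin (px + 1), boldBT k βp a (Sum.inl i)
          * (φm ((jj : ℕ) + 2) i - φp ((jj : ℕ) + 2) i)
    | Sum.inr (Sum.inl _), Sum.inl b => boldA k (PhiOf φp Φx) αp (Sum.inl 0) b
    | Sum.inr (Sum.inl _), Sum.inr (Sum.inl _) => (1 + (φm 1 0 - φp 1 0)) * δ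
    | Sum.inr (Sum.inl _), Sum.inr (Sum.inr jj) => φm ((jj : ℕ) + 2) 0 - φp ((jj : ℕ) + 2) 0
    | Sum.inr (Sum.inr _), Sum.inl _ => 0
    | Sum.inr (Sum.inr jr), Sum.inr (Sum.inl _) => if (jr : ℕ) = 0 then δ else 0
    | Sum.inr (Sum.inr jr), Sum.inr (Sum.inr jc) => if (jc : ℕ) + 1 = (jr : ℕ) then 1 else 0

/-- The intercept vector `𝛍 = (𝛃⁺_{1:p}ᵀ c; e₁ᵀc; 0)`. -/
def muF (k : ℕ) {r : ℕ} (βp : Matrix (Fin (px + 1)) (Fin r) ℝ) (c : Fin (px + 1) → ℝ) :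
    ((Fin r ⊕ Fin (k - 1) × Fin (px + 1)) ⊕ (Unit ⊕ Fin (k - 1))) → ℝ :=
  Sum.elim (fun a => ∑ i : Fin (px + 1), boldBT k βp a (Sum.inl i) * c i)
    (Sum.elim (fun _ => c 0) (fun _ => 0))

/-- Summation by parts for a finite sum of matrix-vector products. -/
theorem sum_mulVec_eq_sum_mulVec_sub {n : Type*} [Fintype n] (A : ℕ → Matrix n n ℝ)
    (w : ℕ → n → ℝ) (N : ℕ) :
    ∑ i ∈ Finset.Icc 1 (N + 1), A i *ᵥ w i =
      (∑ i ∈ Finset.Icc 1 (N + 1), A i) *ᵥ w 1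
        + ∑ m ∈ Finset.range N,
            (-∑ j ∈ Finset.Icc (m + 2) (N + 1), A j) *ᵥ (w (m + 1) - w (m + 2)) := by
  induction N with
  | zero => simp
  | succ N ih =>
    have htel : ∑ m ∈ Finset.range (N + 1), (w (m + 1) - w (m + 2)) = w 1 - w (N + 2) :=
      Finset.sum_range_sub' (fun m => w (m + 1)) (N + 1)
    have hstep : ∀ m ∈ Finset.range (N + 1),
        (-∑ j ∈ Finset.Icc (m + 2) (N + 1 + 1), A j) *ᵥ (w (m + 1) - w (m + 2)) =
          (-∑ j ∈ Finset.Icc (m + 2) (N + 1), A j) *ᵥ (w (m + 1) - w (m + 2))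
            - A (N + 2) *ᵥ (w (m + 1) - w (m + 2)) := by
      intro m hm
      have := Finset.mem_range.mp hm
      rw [Finset.sum_Icc_succ_top (by omega), neg_add, add_mulVec, neg_mulVec _ (A (N + 1 + 1))]
      exact (sub_eq_add_neg _ _).symm
    rw [Finset.sum_Icc_succ_top (b := N + 1) (by omega),
      Finset.sum_Icc_succ_top (b := N + 1) (by omega), ih,
      Finset.sum_congr rfl hstep, Finset.sum_sub_distrib, ← mulVec_sum, htel,
      Finset.sum_range_succ, add_mulVec, mulVec_sub (A (N + 2)),
      Finset.Icc_eq_empty (a := N + 2) (b := N + 1) (by omega), Finset.sum_empty, neg_zero,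
      zero_mulVec]
    abel

theorem boldA_mulVec_inl (k : ℕ) {r : ℕ}
    (Φ : ℕ → Matrix (Fin (px + 1)) (Fin (px + 1)) ℝ) (α : Matrix (Fin (px + 1)) (Fin r) ℝ)
    (v : Fin r ⊕ Fin (k - 1) × Fin (px + 1) → ℝ) (l : Fin (px + 1)) :
    (boldA k Φ α *ᵥ v) (Sum.inl l) =
      (α *ᵥ fun a => v (Sum.inl a)) l
        + ∑ m : Fin (k - 1), (Γmat k Φ ((m : ℕ) + 1) *ᵥ fun j => v (Sum.inr (m, j))) l := by
  simp [mulVec, dotProduct, boldA, Fintype.sum_prod_type]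

theorem boldA_mulVec_inr (k : ℕ) {r : ℕ}
    (Φ : ℕ → Matrix (Fin (px + 1)) (Fin (px + 1)) ℝ) (α : Matrix (Fin (px + 1)) (Fin r) ℝ)
    (v : Fin r ⊕ Fin (k - 1) × Fin (px + 1) → ℝ) (m : Fin (k - 1) × Fin (px + 1)) :
    (boldA k Φ α *ᵥ v) (Sum.inr m) = v (Sum.inr m) := by
  simp [mulVec, dotProduct, boldA, ← Prod.ext_iff]

theorem PhiOf_mulVec_zf (φ : ℕ → Fin (px + 1) → ℝ)
    (Φx : ℕ → Matrix (Fin (px + 1)) (Fin px) ℝ) (y : ℤ → ℝ) (x : ℤ → Fin px → ℝ)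
    (i : ℕ) (t : ℤ) :
    PhiOf φ Φx i *ᵥ zf y x t = y t • φ i + Φx i *ᵥ x t := by
  ext l
  simp [mulVec, dotProduct, PhiOf, zf, Fin.sum_univ_succ, mul_comm]

/-- The equilibrium-correction form of the canonical CKSVAR. -/
theorem zf_sub_zf_eq {k r : ℕ} (hk : 1 ≤ k)
    (φp φm : ℕ → Fin (px + 1) → ℝ) (Φx : ℕ → Matrix (Fin (px + 1)) (Fin px) ℝ)
    (c : Fin (px + 1) → ℝ) (u : ℤ → Fin (px + 1) → ℝ)
    (y : ℤ → ℝ) (x : ℤ → Fin px → ℝ) (αp βp : Matrix (Fin (px + 1)) (Fin r) ℝ)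
    (hfact : (∑ i ∈ Finset.Icc 1 k, PhiOf φp Φx i) - 1 = αp * βpᵀ) (t : ℤ)
    (hmodel : zf y x t = c + ∑ i ∈ Finset.Icc 1 k,
        (max (y (t - (i : ℤ))) 0 • φp i + min (y (t - (i : ℤ))) 0 • φm i
          + (Φx i).mulVec (x (t - (i : ℤ)))) + u t) (l : Fin (px + 1)) :
    zf y x t l - zf y x (t - 1) l =
      c l + (boldA k (PhiOf φp Φx) αp *ᵥ bxiP k βp y x (t - 1)) (Sum.inl l)
        + ∑ i ∈ Finset.Icc 1 k, (φm i l - φp i l) * min (y (t - (i : ℤ))) 0 + u t l := by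
  obtain ⟨n, rfl⟩ : ∃ n, k = n + 1 := ⟨k - 1, by omega⟩
  have hterm : ∀ i : ℕ, max (y (t - (i : ℤ))) 0 • φp i + min (y (t - (i : ℤ))) 0 • φm i
      + (Φx i).mulVec (x (t - (i : ℤ))) =
        PhiOf φp Φx i *ᵥ zf y x (t - (i : ℤ))
          + min (y (t - (i : ℤ))) 0 • (φm i - φp i) := by
    intro i
    rw [PhiOf_mulVec_zf, ← sub_eq_iff_eq_add.mpr (max_add_min (y (t - (i : ℤ))) 0).symm]
    module
  have hparts := sum_mulVec_eq_sum_mulVec_sub (PhiOf φp Φx)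
    (fun i => zf y x (t - (i : ℤ))) n
  rw [sub_eq_iff_eq_add.mp hfact] at hparts
  rw [boldA_mulVec_inl]
  have hα : (αp *ᵥ fun a => bxiP (n + 1) βp y x (t - 1) (Sum.inl a)) l =
      ((αp * βpᵀ) *ᵥ zf y x (t - 1)) l := by
    rw [← mulVec_mulVec]; rfl
  have hΓ : ∑ m : Fin (n + 1 - 1), (Γmat (n + 1) (PhiOf φp Φx) ((m : ℕ) + 1) *ᵥ
        fun j => bxiP (n + 1) βp y x (t - 1) (Sum.inr (m, j))) l =
      ∑ m ∈ Finset.range n, ((-∑ j ∈ Finset.Icc (m + 2) (n + 1), PhiOf φp Φx j) *ᵥ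
        (zf y x (t - ((m + 1 : ℕ) : ℤ)) - zf y x (t - ((m + 2 : ℕ) : ℤ)))) l := by
    rw [Finset.sum_range]
    refine Finset.sum_congr rfl fun m _ => ?_
    have h1 : t - 1 - ((m : ℕ) : ℤ) = t - (((m : ℕ) + 1 : ℕ) : ℤ) := by push_cast; ring
    have h2 : t - 1 - ((m : ℕ) : ℤ) - 1 = t - (((m : ℕ) + 2 : ℕ) : ℤ) := by push_cast; ring
    rw [← h2, ← h1]
    rfl
  rw [hα, hΓ, hmodel]
  simp only [hterm, Finset.sum_add_distrib, hparts, add_mulVec, one_mulVec, Pi.add_apply,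
    Finset.sum_apply, Pi.smul_apply, Pi.sub_apply, smul_eq_mul, Nat.cast_one, mul_comm]
  ring

theorem boldBT_mulVec_inl (k : ℕ) {r : ℕ} (β : Matrix (Fin (px + 1)) (Fin r) ℝ)
    (v : Fin (px + 1) ⊕ Fin (k - 1) × Fin (px + 1) → ℝ) (a : Fin r) :
    (boldBT k β *ᵥ v) (Sum.inl a) = (βᵀ *ᵥ fun l => v (Sum.inl l)) a := by
  simp [mulVec, dotProduct, boldBT]

/-- The product of `𝛃⁺ᵀ` with the stack `(Δz_t; Δz_{t−1}; …; Δz_{t−k+1})` is the increment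
of `𝛏_t⁺`. -/
theorem boldBT_mulVec_increments (k : ℕ) {r : ℕ} (β : Matrix (Fin (px + 1)) (Fin r) ℝ)
    (y : ℤ → ℝ) (x : ℤ → Fin px → ℝ) (t : ℤ) :
    boldBT k β *ᵥ Sum.elim (fun l => zf y x t l - zf y x (t - 1) l)
        (fun m => bxiP k β y x (t - 1) (Sum.inr m)) =
      bxiP k β y x t - bxiP k β y x (t - 1) := by
  ext a
  rcases a with a | ⟨m, l⟩
  · rw [boldBT_mulVec_inl]
    simp only [Sum.elim_inl, bxiP, Pi.sub_apply]
    rw [← Pi.sub_apply, ← mulVec_sub]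
    rfl
  · have hsplit : ∀ q : Fin (k - 1) × Fin (px + 1),
        boldBT k β (Sum.inr (m, l)) (Sum.inr q) =
          (if q = (m, l) then -1 else 0)
            + (if (q.1 : ℕ) + 1 = (m : ℕ) ∧ l = q.2 then 1 else 0) := by
      rintro ⟨m', l'⟩
      by_cases h : m' = m ∧ l = l'
      · obtain ⟨rfl, rfl⟩ := h
        simp [boldBT]
      · have h' : ¬ ((m', l') = (m, l)) := by
          simp only [Prod.mk.injEq]; tauto
        simp [boldBT, h, h', -Prod.mk.injEq]
    simp only [mulVec, dotProduct, Fintype.sum_sum_type, hsplit, Sum.elim_inl, Sum.elim_inr,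
      add_mul, Finset.sum_add_distrib, ite_mul, neg_mul, one_mul, zero_mul, Finset.sum_ite_eq',
      Finset.mem_univ, if_true, Pi.sub_apply]
    obtain ⟨m, hm⟩ := m
    rcases m with _ | m
    · simp [boldBT, bxiP]
      ring
    · rw [Fintype.sum_prod_type, Finset.sum_eq_single (⟨m, by omega⟩ : Fin (k - 1))]
      · simp [boldBT, bxiP]
        ring_nf
      · intro b _ hb
        have : (b : ℕ) ≠ m := fun h => hb (Fin.ext h)
        simp [this]
      · simp

theorem sum_Icc_two_eq_sum_fin (k : ℕ) (f : ℕ → ℝ) :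
    ∑ i ∈ Finset.Icc 2 k, f i = ∑ j : Fin (k - 1), f ((j : ℕ) + 2) := by
  rw [← Finset.sum_range fun j => f (j + 2), Finset.range_eq_Ico,
    Finset.sum_Ico_add' f 0 (k - 1) 2]
  refine Finset.sum_congr ?_ fun _ _ => rfl
  ext i
  simp only [Finset.mem_Icc, Finset.mem_Ico]
  omega

theorem sum_Icc_one_eq_add_sum_Icc_two {k : ℕ} (hk : 1 ≤ k) (f : ℕ → ℝ) :
    ∑ i ∈ Finset.Icc 1 k, f i = f 1 + ∑ i ∈ Finset.Icc 2 k, f i := by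
  rw [← Finset.insert_Icc_succ_left_eq_Icc hk, Finset.sum_insert (by simp)]
  rfl

theorem eq_max_add_yhatF {k r : ℕ} (hk : 1 ≤ k)
    (φp φm : ℕ → Fin (px + 1) → ℝ) (Φx : ℕ → Matrix (Fin (px + 1)) (Fin px) ℝ)
    (c : Fin (px + 1) → ℝ) (u : ℤ → Fin (px + 1) → ℝ)
    (y : ℤ → ℝ) (x : ℤ → Fin px → ℝ) (αp βp : Matrix (Fin (px + 1)) (Fin r) ℝ) (t : ℤ)
    (ht : 1 ≤ t)
    (hincr : zf y x t 0 - zf y x (t - 1) 0 =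
      c 0 + (boldA k (PhiOf φp Φx) αp *ᵥ bxiP k βp y x (t - 1)) (Sum.inl 0)
        + ∑ i ∈ Finset.Icc 1 k, (φm i 0 - φp i 0) * min (y (t - (i : ℤ))) 0 + u t 0) :
    y t = max (y (t - 1)) 0 + yhatF k φp φm Φx αp βp c y x u t := by
  rw [sum_Icc_one_eq_add_sum_Icc_two hk] at hincr
  simp only [zf, Fin.cons_zero, mulVec, dotProduct, Nat.cast_one] at hincr
  rw [yhatF, if_pos ht]
  linarith [max_add_min (y (t - 1)) 0]

theorem min_eq_deltaF_mul_yhatF {k r : ℕ}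
    (φp φm : ℕ → Fin (px + 1) → ℝ) (Φx : ℕ → Matrix (Fin (px + 1)) (Fin px) ℝ)
    (c : Fin (px + 1) → ℝ) (u : ℤ → Fin (px + 1) → ℝ)
    (y : ℤ → ℝ) (x : ℤ → Fin px → ℝ) (αp βp : Matrix (Fin (px + 1)) (Fin r) ℝ) (t : ℤ)
    (hy : 1 ≤ t → y t = max (y (t - 1)) 0 + yhatF k φp φm Φx αp βp c y x u t) :
    min (y t) 0 = deltaF k φp φm Φx αp βp c y x u t * yhatF k φp φm Φx αp βp c y x u t := by
  by_cases ht : 1 ≤ t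
  · rw [deltaF, if_pos ht, ← hy ht]
    split_ifs with hneg
    · have hne : yhatF k φp φm Φx αp βp c y x u t ≠ 0 := by
        have := hy ht
        have := le_max_right (y (t - 1)) 0
        exact ne_of_lt (by linarith)
      rw [min_eq_left hneg.le, div_mul_cancel₀ _ hne]
    · rw [min_eq_right (not_lt.mp hneg), zero_mul]
  · rw [deltaF, if_neg ht, yhatF, if_neg ht, one_mul]

/-- Lemma statcomp: nonlinear VAR representation of the short-memory
components of a canonical CKSVAR, case (i).  For every `t ≥ 1`,
`ζ_t = 𝛍 + F_{δ_{t−1}} ζ_{t−1} + 𝛆_t` and `y_t⁻ = δ_t ŷ_t`. -/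
theorem statcomp {k r : ℕ} (hk : 2 ≤ k)
    (φp φm : ℕ → Fin (px + 1) → ℝ) (Φx : ℕ → Matrix (Fin (px + 1)) (Fin px) ℝ)
    (c : Fin (px + 1) → ℝ) (u : ℤ → Fin (px + 1) → ℝ)
    (y : ℤ → ℝ) (x : ℤ → Fin px → ℝ)
    -- the canonical CKSVAR equation
    (hmodel : ∀ t : ℤ, 1 ≤ t →
      zf y x t = c + ∑ i ∈ Finset.Icc 1 k,
        (max (y (t - (i : ℤ))) 0 • φp i + min (y (t - (i : ℤ))) 0 • φm i
          + (Φx i).mulVec (x (t - (i : ℤ)))) + u t)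
    -- rank and factorisation of Π⁺
    (Piplus : Matrix (Fin (px + 1)) (Fin (px + 1)) ℝ)
    (hPiplus : Piplus = (∑ i ∈ Finset.Icc 1 k, PhiOf φp Φx i) - 1)
    (hrank : Piplus.rank = r)
    (αp βp : Matrix (Fin (px + 1)) (Fin r) ℝ)
    (hαp : αp.rank = r) (hβp : βp.rank = r) (hfact : Piplus = αp * βpᵀ) :
    ∀ t : ℤ, 1 ≤ t →
      (zetaF k φp φm Φx αp βp c y x u t
        = muF k βp c
          + (Fmat k φp φm Φx αp βp (deltaF k φp φm Φx αp βp c y x u (t - 1))).mulVec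
              (zetaF k φp φm Φx αp βp c y x u (t - 1))
          + Sum.elim (fun a => ∑ i : Fin (px + 1), boldBT k βp a (Sum.inl i) * u t i)
              (Sum.elim (fun _ => u t 0) (fun _ => 0)))
      ∧ min (y t) 0
          = deltaF k φp φm Φx αp βp c y x u t * yhatF k φp φm Φx αp βp c y x u t := by
  subst hPiplus
  have hincr := fun (t : ℤ) (ht : 1 ≤ t) =>
    zf_sub_zf_eq (by omega) φp φm Φx c u y x αp βp hfact t (hmodel t ht)
  have hmin := fun t : ℤ => min_eq_deltaF_mul_yhatF φp φm Φx c u y x αp βp t fun ht =>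
    eq_max_add_yhatF (by omega) φp φm Φx c u y x αp βp t ht (hincr t ht 0)
  intro t ht
  refine ⟨?_, hmin t⟩
  have hlag : ∀ j : ℕ, t - 1 - 1 - (j : ℤ) = t - ((j + 2 : ℕ) : ℤ) := by
    intro j; push_cast; ring
  have hδ := hmin (t - 1)
  ext a
  rcases a with a | _ | j
  · have hstack : (Sum.elim (fun l => zf y x t l - zf y x (t - 1) l)
        (fun m => bxiP k βp y x (t - 1) (Sum.inr m)) :
          Fin (px + 1) ⊕ Fin (k - 1) × Fin (px + 1) → ℝ) =
        boldA k (PhiOf φp Φx) αp *ᵥ bxiP k βp y x (t - 1) +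
          Sum.elim (fun l => c l
            + ∑ i ∈ Finset.Icc 1 k, (φm i l - φp i l) * min (y (t - (i : ℤ))) 0 + u t l) 0 := by
      ext i
      rcases i with l | m
      · simp only [Sum.elim_inl, Pi.add_apply, hincr t ht]
        ring
      · simp [boldA_mulVec_inr]
    have hξ := congrFun (boldBT_mulVec_increments k βp y x t) a
    rw [hstack, mulVec_add, mulVec_mulVec] at hξ
    have hg : (boldBT k βp *ᵥ Sum.elim (fun l => c l
          + ∑ i ∈ Finset.Icc 1 k, (φm i l - φp i l) * min (y (t - (i : ℤ))) 0 + u t l) 0) a =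
        ∑ i, boldBT k βp a (Sum.inl i) * c i
          + (∑ i, boldBT k βp a (Sum.inl i) * (φm 1 i - φp 1 i)) * min (y (t - 1)) 0
          + ∑ j : Fin (k - 1), (∑ i, boldBT k βp a (Sum.inl i)
              * (φm ((j : ℕ) + 2) i - φp ((j : ℕ) + 2) i)) * min (y (t - 1 - 1 - ((j : ℕ) : ℤ))) 0
          + ∑ i, boldBT k βp a (Sum.inl i) * u t i := by
      simp only [mulVec, dotProduct, Fintype.sum_sum_type, Sum.elim_inl, Sum.elim_inr,
        Pi.zero_apply, mul_zero, Finset.sum_const_zero, add_zero, mul_add, Finset.sum_add_distrib,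
        sum_Icc_one_eq_add_sum_Icc_two (show 1 ≤ k by omega), sum_Icc_two_eq_sum_fin,
        Finset.sum_mul, Finset.mul_sum, hlag, Nat.cast_one]
      rw [Finset.sum_comm (γ := Fin (k - 1))]
      simp only [mul_assoc, add_assoc]
    have hF : (Fmat k φp φm Φx αp βp (deltaF k φp φm Φx αp βp c y x u (t - 1)) *ᵥ
          zetaF k φp φm Φx αp βp c y x u (t - 1)) (Sum.inl a) =
        ((1 + boldBT k βp * boldA k (PhiOf φp Φx) αp) *ᵥ bxiP k βp y x (t - 1)) a
          + ((∑ i, boldBT k βp a (Sum.inl i) * (φm 1 i - φp 1 i)) * min (y (t - 1)) 0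
          + ∑ j : Fin (k - 1), (∑ i, boldBT k βp a (Sum.inl i)
              * (φm ((j : ℕ) + 2) i - φp ((j : ℕ) + 2) i))
                * min (y (t - 1 - 1 - ((j : ℕ) : ℤ))) 0) := by
      rw [hδ, ← mul_assoc]
      simp [mulVec, dotProduct, Fmat, zetaF]
    simp only [Pi.add_apply, hF, add_mulVec, one_mulVec]
    simp only [Pi.add_apply, Pi.sub_apply, hg] at hξ
    simp only [zetaF, muF, Sum.elim_inl]
    linarith
  · have hF : (Fmat k φp φm Φx αp βp (deltaF k φp φm Φx αp βp c y x u (t - 1)) *ᵥ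
          zetaF k φp φm Φx αp βp c y x u (t - 1)) (Sum.inr (Sum.inl ())) =
        ∑ b, boldA k (PhiOf φp Φx) αp (Sum.inl 0) b * bxiP k βp y x (t - 1) b
          + ((1 + (φm 1 0 - φp 1 0)) * min (y (t - 1)) 0
          + ∑ j : Fin (k - 1), (φm ((j : ℕ) + 2) 0 - φp ((j : ℕ) + 2) 0)
                * min (y (t - 1 - 1 - ((j : ℕ) : ℤ))) 0) := by
      rw [hδ, ← mul_assoc]
      simp [mulVec, dotProduct, Fmat, zetaF]
    simp only [Pi.add_apply]
    rw [hF]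
    simp only [zetaF, muF, Sum.elim_inl, Sum.elim_inr]
    rw [yhatF, if_pos ht, sum_Icc_two_eq_sum_fin]
    simp only [hlag]
    ring
  · simp only [Pi.add_apply, mulVec, dotProduct, Fintype.sum_sum_type, Fmat, zetaF, muF,
      Sum.elim_inl, Sum.elim_inr, of_apply, zero_mul, Finset.sum_const_zero, zero_add, add_zero]
    obtain ⟨j, hj⟩ := j
    rcases j with _ | j
    · simp [hδ]
    · rw [Finset.sum_eq_single (⟨j, by omega⟩ : Fin (k - 1)) (s := Finset.univ (α := Fin (k - 1)))]
      · simp only [if_true, one_mul, Nat.add_eq_zero_iff, one_ne_zero, and_false, if_false,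
          zero_mul, Finset.sum_const_zero, zero_add]
        congr 2
        push_cast
        ring
      · intro b _ hb
        have : (b : ℕ) ≠ j := fun h => hb (Fin.ext h)
        simp [this]
      · simp

end CKSVARCaseI
end

section
/- Let c ∈ ℝ^m, d ∈ ℝ^n, and A, B₁, B₂ ∈ ℝ^{m×n} have full column rank, with B₁ − B₂ = c·dᵀ and det(AᵀB₁)·det(AᵀB₂) > 0. Then there exists μ > 0 such that dᵀ(AᵀB₁)^{-1} = μ·dᵀ(AᵀB₂)^{-1}. -/
open Matrix

/-- The matrix determinant lemma for a rank-one update written with `vecMulVec`. -/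
theorem Matrix.det_add_vecMulVec_of_isUnit {ι R : Type*} [Fintype ι] [DecidableEq ι] [CommRing R]
    {M : Matrix ι ι R} (hM : IsUnit M.det) (u v : ι → R) :
    (M + vecMulVec u v).det = M.det * (1 + (v ᵥ* M⁻¹) ⬝ᵥ u) := by
  rw [vecMulVec_eq Unit, det_add_replicateCol_mul_replicateRow (ι := Unit) hM,
    ← replicateRow_vecMul, det_unique (n := Unit), Matrix.add_apply, one_apply_eq,
    replicateRow_mul_replicateCol_apply]

/-- A rank-one update `M + u vᵀ` rescales the row vector `vᵀ M⁻¹`. -/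
theorem Matrix.vecMul_inv_add_vecMulVec {ι K : Type*} [Fintype ι] [DecidableEq ι] [Field K]
    {M : Matrix ι ι K} (hM : M.det ≠ 0) (u v : ι → K) (h : (M + vecMulVec u v).det ≠ 0) :
    v ᵥ* (M + vecMulVec u v)⁻¹ = (M.det / (M + vecMulVec u v).det) • (v ᵥ* M⁻¹) := by
  have hdet := det_add_vecMulVec_of_isUnit hM.isUnit u v
  have hs : M.det / (M + vecMulVec u v).det * (1 + (v ᵥ* M⁻¹) ⬝ᵥ u) = 1 := by
    rw [div_mul_eq_mul_div, ← hdet, div_self h]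
  have hadd : (1 + (v ᵥ* M⁻¹) ⬝ᵥ u) • v = v + ((v ᵥ* M⁻¹) ⬝ᵥ u) • v := by
    rw [add_smul, one_smul]
  have hv : ((M.det / (M + vecMulVec u v).det) • (v ᵥ* M⁻¹)) ᵥ* (M + vecMulVec u v) = v := by
    rw [smul_vecMul, vecMul_add, vecMul_vecMul, nonsing_inv_mul _ hM.isUnit, vecMul_one,
      vecMul_vecMulVec, ← hadd, smul_smul, hs, one_smul]
  have hinv := congrArg (· ᵥ* (M + vecMulVec u v)⁻¹) hv
  simp only [vecMul_vecMul, mul_nonsing_inv _ h.isUnit, vecMul_one] at hinv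
  exact hinv.symm

/-- Lemma on rank-one perturbations, part (i).
If `A, B₁, B₂ ∈ ℝ^{m×n}` have full column rank, `B₁ − B₂ = c dᵀ` and
`det(AᵀB₁) · det(AᵀB₂) > 0`, then there exists `μ > 0` such that
`dᵀ(AᵀB₁)⁻¹ = μ · dᵀ(AᵀB₂)⁻¹`. -/
theorem rank_one_perturbation_row {m n : ℕ} (hn : 1 ≤ n) (hmn : n ≤ m)
    (c : Fin m → ℝ) (d : Fin n → ℝ)
    (A B₁ B₂ : Matrix (Fin m) (Fin n) ℝ)
    (hA : A.rank = n) (hB₁ : B₁.rank = n) (hB₂ : B₂.rank = n)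
    (hdiff : B₁ - B₂ = Matrix.vecMulVec c d)
    (hdet : 0 < (Aᵀ * B₁).det * (Aᵀ * B₂).det) :
    ∃ μ : ℝ, 0 < μ ∧
      Matrix.vecMul d (Aᵀ * B₁)⁻¹ = μ • Matrix.vecMul d (Aᵀ * B₂)⁻¹ := by
  have h : Aᵀ * B₁ = Aᵀ * B₂ + vecMulVec (Aᵀ *ᵥ c) d := by
    rw [← mul_vecMulVec, ← hdiff, ← Matrix.mul_add, add_sub_cancel]
  refine ⟨(Aᵀ * B₂).det / (Aᵀ * B₁).det, ?_, ?_⟩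
  · rw [mul_comm] at hdet
    exact div_pos_iff.2 (mul_pos_iff.1 hdet)
  · have h₁ := left_ne_zero_of_mul hdet.ne'
    rw [h] at h₁ ⊢
    exact vecMul_inv_add_vecMulVec (right_ne_zero_of_mul hdet.ne') _ _ h₁
end

section
/- In the kinked-cointegration setup of the context, suppose sgn det(α_⊥ᵀΓ⁺β_⊥(+1)) = sgn det(α_⊥ᵀΓ⁻β_⊥(−1)) ≠ 0. Then, with ϑᵀ := e₁ᵀP_{β_⊥}(+1), we have ϑ ≠ 0 and there exists μ > 0 such that for every y ∈ ℝ: e₁ᵀP_{β_⊥}(y) = h(y)·ϑᵀ, where h(y) := 1 if y ≥ 0 and h(y) := μ if y < 0. In particular e₁ᵀP_{β_⊥}(−1) = μ·ϑᵀ. -/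
open Matrix

namespace Kinked

/-- The matrix `β_⊥ = [[1, 0], [−θ, β_{x,⊥}]] ∈ ℝ^{p×q}` (with `p = px+1`, `q = qx+1`). -/
def betaPerpM {px qx : ℕ} (θ : Fin px → ℝ) (bx : Matrix (Fin px) (Fin qx) ℝ) :
    Matrix (Fin (px + 1)) (Fin (qx + 1)) ℝ :=
  Matrix.of (Fin.cons (Fin.cons 1 (fun _ => 0)) (fun i => Fin.cons (-(θ i)) (fun j => bx i j)))

/-- The projection `P_{β_⊥} = β_⊥ [α_⊥ᵀ Γ β_⊥]⁻¹ α_⊥ᵀ`. -/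
noncomputable def Pproj {px qx : ℕ} (αperp : Matrix (Fin (px + 1)) (Fin (qx + 1)) ℝ)
    (Γ : Matrix (Fin (px + 1)) (Fin (px + 1)) ℝ)
    (B : Matrix (Fin (px + 1)) (Fin (qx + 1)) ℝ) :
    Matrix (Fin (px + 1)) (Fin (px + 1)) ℝ :=
  B * (αperpᵀ * Γ * B)⁻¹ * αperpᵀ

/-- Row `0` of the adjugate does not depend on column `0` of the matrix. -/
lemma adjugate_zero_row_congr {n : ℕ} {M N : Matrix (Fin (n + 1)) (Fin (n + 1)) ℝ}
    (h : ∀ i j, j ≠ 0 → M i j = N i j) (j : Fin (n + 1)) :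
    M.adjugate 0 j = N.adjugate 0 j := by
  rw [adjugate_fin_succ_eq_det_submatrix, adjugate_fin_succ_eq_det_submatrix]
  congr 2
  ext a b
  exact h _ _ (Fin.succAbove_ne 0 b)

lemma betaPerpM_zero_row_mul {px qx m : ℕ} (θ : Fin px → ℝ) (bx : Matrix (Fin px) (Fin qx) ℝ)
    (A : Matrix (Fin (qx + 1)) (Fin m) ℝ) (j : Fin m) :
    (betaPerpM θ bx * A) 0 j = A 0 j := by
  simp [Matrix.mul_apply, betaPerpM, Fin.sum_univ_succ]

lemma Pproj_zero_row {px qx : ℕ} (αperp : Matrix (Fin (px + 1)) (Fin (qx + 1)) ℝ)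
    (Γ : Matrix (Fin (px + 1)) (Fin (px + 1)) ℝ) (θ : Fin px → ℝ)
    (bx : Matrix (Fin px) (Fin qx) ℝ) (j : Fin (px + 1)) :
    Pproj αperp Γ (betaPerpM θ bx) 0 j =
      (αperpᵀ * Γ * betaPerpM θ bx).det⁻¹ *
        ∑ k, (αperpᵀ * Γ * betaPerpM θ bx).adjugate 0 k * αperp j k := by
  rw [Pproj, Matrix.mul_assoc, betaPerpM_zero_row_mul, Matrix.inv_def, Ring.inverse_eq_inv',
    Matrix.smul_mul, Matrix.smul_apply, Matrix.mul_apply, smul_eq_mul]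
  rfl

/-- Away from column `0`, the matrix `α_⊥ᵀ Γ β_⊥` depends neither on `θ` nor on column `0` of
`Γ`. -/
lemma mul_betaPerpM_congr {px qx : ℕ} (αperp : Matrix (Fin (px + 1)) (Fin (qx + 1)) ℝ)
    {Γ Γ' : Matrix (Fin (px + 1)) (Fin (px + 1)) ℝ} (hΓ : ∀ i j, j ≠ 0 → Γ i j = Γ' i j)
    (θ θ' : Fin px → ℝ) (bx : Matrix (Fin px) (Fin qx) ℝ) (i j : Fin (qx + 1)) (hj : j ≠ 0) :
    (αperpᵀ * Γ * betaPerpM θ bx) i j = (αperpᵀ * Γ' * betaPerpM θ' bx) i j := by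
  obtain ⟨j, rfl⟩ := Fin.exists_succ_eq.mpr hj
  have h : ∀ a (b : Fin px), Γ a b.succ = Γ' a b.succ := fun a b => hΓ a _ (Fin.succ_ne_zero b)
  rw [Matrix.mul_apply, Matrix.mul_apply]
  simp [betaPerpM, Fin.sum_univ_succ, Matrix.mul_apply, h]

lemma Pproj_zero_row_ne_zero {px qx : ℕ} (αperp : Matrix (Fin (px + 1)) (Fin (qx + 1)) ℝ)
    (Γ : Matrix (Fin (px + 1)) (Fin (px + 1)) ℝ) (θ : Fin px → ℝ)
    (bx : Matrix (Fin px) (Fin qx) ℝ) (hdet : (αperpᵀ * Γ * betaPerpM θ bx).det ≠ 0) :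
    (fun j => Pproj αperp Γ (betaPerpM θ bx) 0 j) ≠ 0 := by
  intro h
  have hrow : (Pproj αperp Γ (betaPerpM θ bx) * (Γ * betaPerpM θ bx)) 0 0 = 0 := by
    rw [Matrix.mul_apply]
    exact Finset.sum_eq_zero fun k _ => by rw [congrFun h k]; simp
  have hmul : Pproj αperp Γ (betaPerpM θ bx) * (Γ * betaPerpM θ bx) = betaPerpM θ bx := by
    rw [Pproj, Matrix.mul_assoc, ← Matrix.mul_assoc αperpᵀ, Matrix.mul_assoc,
      Matrix.nonsing_inv_mul _ (isUnit_iff_ne_zero.mpr hdet), Matrix.mul_one]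
  rw [hmul] at hrow
  simp [betaPerpM] at hrow

/-- kinked cointegration: the first row of `P_{β_⊥}(y)`.
If `sgn det(α_⊥ᵀΓ⁺β_⊥(+1)) = sgn det(α_⊥ᵀΓ⁻β_⊥(−1)) ≠ 0`, then with
`ϑᵀ := e₁ᵀ P_{β_⊥}(+1)` we have `ϑ ≠ 0` and there is `μ > 0` such that
`e₁ᵀ P_{β_⊥}(y) = h(y) ϑᵀ` for all `y`, where `h(y) = 1` for `y ≥ 0` and `h(y) = μ`
for `y < 0`. -/
theorem kinked_first_row {px qx r : ℕ} (hpx : 1 ≤ px) (hq : qx ≤ px) (hr : r = px - qx)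
    (α : Matrix (Fin (px + 1)) (Fin r) ℝ) (hα : α.rank = r)
    (αperp : Matrix (Fin (px + 1)) (Fin (qx + 1)) ℝ) (hαperp : αperp.rank = qx + 1)
    (horth : αperpᵀ * α = 0)
    (θp θm : Fin px → ℝ) (bx : Matrix (Fin px) (Fin qx) ℝ) (hbx : bx.rank = qx)
    (Γp Γm : Matrix (Fin (px + 1)) (Fin (px + 1)) ℝ)
    (hΓ : ∀ i j, j ≠ 0 → Γp i j = Γm i j)
    (hdet : 0 < (αperpᵀ * Γp * betaPerpM θp bx).det * (αperpᵀ * Γm * betaPerpM θm bx).det) :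
    (fun j => Pproj αperp Γp (betaPerpM θp bx) 0 j) ≠ 0 ∧
    ∃ μ : ℝ, 0 < μ ∧ ∀ y : ℝ, ∀ j,
      (if 0 ≤ y then Pproj αperp Γp (betaPerpM θp bx)
       else Pproj αperp Γm (betaPerpM θm bx)) 0 j
        = (if 0 ≤ y then 1 else μ) * Pproj αperp Γp (betaPerpM θp bx) 0 j := by
  have hp := left_ne_zero_of_mul hdet.ne'
  have hm := right_ne_zero_of_mul hdet.ne'
  refine ⟨Pproj_zero_row_ne_zero _ _ _ _ hp,
    (αperpᵀ * Γp * betaPerpM θp bx).det / (αperpᵀ * Γm * betaPerpM θm bx).det,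
    div_pos_iff.mpr (mul_pos_iff.mp hdet), fun y j => ?_⟩
  split_ifs with hy
  · rw [one_mul]
  · simp_rw [Pproj_zero_row,
      adjugate_zero_row_congr (mul_betaPerpM_congr αperp hΓ θp θm bx)]
    field_simp

end Kinked
end

section
/- In the kinked-cointegration setup of the context, suppose sgn det(α_⊥ᵀΓ⁺β_⊥(+1)) = sgn det(α_⊥ᵀΓ⁻β_⊥(−1)) ≠ 0, and let ϑᵀ := e₁ᵀP_{β_⊥}(+1). Then for every u ∈ ℝ^p with ϑᵀu = 0, one has P_{β_⊥}(+1)u = P_{β_⊥}(−1)u. -/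
open Matrix

namespace Kinked

/-- The top entry of `β_⊥ z` is the top entry of `z`. -/
theorem betaPerpM_mulVec_zero {px qx : ℕ} (θ : Fin px → ℝ) (bx : Matrix (Fin px) (Fin qx) ℝ)
    (z : Fin (qx + 1) → ℝ) : (betaPerpM θ bx *ᵥ z) 0 = z 0 := by
  simp [betaPerpM, Matrix.mulVec, dotProduct, Fin.sum_univ_succ]

/-- On vectors with vanishing top entry, `β_⊥` does not depend on `θ`. -/
theorem betaPerpM_mulVec_congr {px qx : ℕ} (θ θ' : Fin px → ℝ) (bx : Matrix (Fin px) (Fin qx) ℝ)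
    {z : Fin (qx + 1) → ℝ} (hz : z 0 = 0) : betaPerpM θ bx *ᵥ z = betaPerpM θ' bx *ᵥ z := by
  ext i
  refine Fin.cases ?_ (fun i => ?_) i <;>
    simp [betaPerpM, Matrix.mulVec, dotProduct, Fin.sum_univ_succ, hz]

/-- Matrices that agree off the first column agree on vectors with vanishing top entry. -/
theorem mulVec_congr_of_zero {m n : ℕ} {A A' : Matrix (Fin m) (Fin (n + 1)) ℝ}
    (h : ∀ i j, j ≠ 0 → A i j = A' i j) {v : Fin (n + 1) → ℝ} (hv : v 0 = 0) :
    A *ᵥ v = A' *ᵥ v := by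
  ext i
  simp [Matrix.mulVec, dotProduct, Fin.sum_univ_succ, hv, h i _ (Fin.succ_ne_zero _)]

/-- `P_{β_⊥} u = β_⊥ z` whenever `z` solves `α_⊥ᵀ Γ β_⊥ z = α_⊥ᵀ u`. -/
theorem Pproj_mulVec_eq {px qx : ℕ} {αperp : Matrix (Fin (px + 1)) (Fin (qx + 1)) ℝ}
    {Γ : Matrix (Fin (px + 1)) (Fin (px + 1)) ℝ} {B : Matrix (Fin (px + 1)) (Fin (qx + 1)) ℝ}
    (h : IsUnit (αperpᵀ * Γ * B).det) {u : Fin (px + 1) → ℝ} {z : Fin (qx + 1) → ℝ}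
    (hz : (αperpᵀ * Γ * B) *ᵥ z = αperpᵀ *ᵥ u) : Pproj αperp Γ B *ᵥ u = B *ᵥ z := by
  rw [Pproj, ← mulVec_mulVec, ← hz, mulVec_mulVec, Matrix.nonsing_inv_mul_cancel_right _ _ h]

/-- kinked cointegration: vectors orthogonal to `ϑ`.
If `sgn det(α_⊥ᵀΓ⁺β_⊥(+1)) = sgn det(α_⊥ᵀΓ⁻β_⊥(−1)) ≠ 0` and `ϑᵀ := e₁ᵀP_{β_⊥}(+1)`,
then for every `u` with `ϑᵀu = 0` one has `P_{β_⊥}(+1)u = P_{β_⊥}(−1)u`. -/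
theorem kinked_orthogonal_agree {px qx r : ℕ} (hpx : 1 ≤ px) (hq : qx ≤ px) (hr : r = px - qx)
    (α : Matrix (Fin (px + 1)) (Fin r) ℝ) (hα : α.rank = r)
    (αperp : Matrix (Fin (px + 1)) (Fin (qx + 1)) ℝ) (hαperp : αperp.rank = qx + 1)
    (horth : αperpᵀ * α = 0)
    (θp θm : Fin px → ℝ) (bx : Matrix (Fin px) (Fin qx) ℝ) (hbx : bx.rank = qx)
    (Γp Γm : Matrix (Fin (px + 1)) (Fin (px + 1)) ℝ)
    (hΓ : ∀ i j, j ≠ 0 → Γp i j = Γm i j)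
    (hdet : 0 < (αperpᵀ * Γp * betaPerpM θp bx).det * (αperpᵀ * Γm * betaPerpM θm bx).det) :
    ∀ u : Fin (px + 1) → ℝ,
      (fun j => Pproj αperp Γp (betaPerpM θp bx) 0 j) ⬝ᵥ u = 0 →
      (Pproj αperp Γp (betaPerpM θp bx)).mulVec u
        = (Pproj αperp Γm (betaPerpM θm bx)).mulVec u := by
  intro u hu
  have hp : IsUnit (αperpᵀ * Γp * betaPerpM θp bx).det :=
    isUnit_iff_ne_zero.2 (left_ne_zero_of_mul hdet.ne')
  have hm : IsUnit (αperpᵀ * Γm * betaPerpM θm bx).det :=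
    isUnit_iff_ne_zero.2 (right_ne_zero_of_mul hdet.ne')
  obtain ⟨z, hz⟩ : ∃ z, (αperpᵀ * Γp * betaPerpM θp bx) *ᵥ z = αperpᵀ *ᵥ u :=
    ⟨(αperpᵀ * Γp * betaPerpM θp bx)⁻¹ *ᵥ (αperpᵀ *ᵥ u), by
      rw [mulVec_mulVec, Matrix.mul_nonsing_inv _ hp, one_mulVec]⟩
  have hv : (betaPerpM θp bx *ᵥ z) 0 = 0 := by
    rw [← Pproj_mulVec_eq hp hz]
    exact hu
  have hz0 : z 0 = 0 := by rwa [betaPerpM_mulVec_zero] at hv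
  have hB := betaPerpM_mulVec_congr θp θm bx hz0
  have hz' : (αperpᵀ * Γm * betaPerpM θm bx) *ᵥ z = αperpᵀ *ᵥ u := by
    rw [← hz, ← mulVec_mulVec, ← mulVec_mulVec, ← mulVec_mulVec, ← mulVec_mulVec, ← hB,
      mulVec_congr_of_zero hΓ hv]
  rw [Pproj_mulVec_eq hp hz, Pproj_mulVec_eq hm hz', hB]

end Kinked
end

section
/- In the kinked-cointegration setup of the context, suppose sgn det(α_⊥ᵀΓ⁺β_⊥(+1)) = sgn det(α_⊥ᵀΓ⁻β_⊥(−1)) ≠ 0. Define g : ℝ × ℝ^p → ℝ^p by g(y,u) := P_{β_⊥}(y)u, let ϑᵀ := e₁ᵀP_{β_⊥}(+1) and h(y) := 1 for y ≥ 0, h(y) := μ for y < 0 (with μ > 0 as in the representation e₁ᵀP_{β_⊥}(y) = h(y)ϑᵀ), and set D_g := {(y,u) ∈ ℝ × ℝ^p : y = h(y)·ϑᵀu}. Then there exists a constant C < ∞ such that for every (y,u) ∈ D_g and every (y′,u′) ∈ ℝ × ℝ^p: ‖g(y,u) − g(y′,u′)‖ ≤ C·(|y − y′| + ‖u − u′‖).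 -/
open Matrix

namespace Kinked

/-- Pack a plain vector into `EuclideanSpace`, so that `‖·‖` is the Euclidean norm. -/
noncomputable def toE {ι : Type*} [Fintype ι] (v : ι → ℝ) : EuclideanSpace ℝ ι :=
  (WithLp.equiv 2 (ι → ℝ)).symm v

/-- A matrix whose columns other than the first vanish acts through the first coordinate only. -/
lemma mulVec_eq_smul_col_zero {m : Type*} {n : ℕ} (M : Matrix m (Fin (n + 1)) ℝ)
    (hM : ∀ i j, j ≠ 0 → M i j = 0) (w : Fin (n + 1) → ℝ) :
    M *ᵥ w = w 0 • fun i => M i 0 := by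
  ext i
  simp only [mulVec, dotProduct, Pi.smul_apply, smul_eq_mul]
  rw [Finset.sum_eq_single 0 (fun j _ hj => by rw [hM i j hj, zero_mul]) (by simp), mul_comm]

lemma betaPerpM_zero_mulVec {px qx : ℕ} (θ : Fin px → ℝ) (bx : Matrix (Fin px) (Fin qx) ℝ)
    (w : Fin (qx + 1) → ℝ) : (betaPerpM θ bx *ᵥ w) 0 = w 0 := by
  simp [mulVec, dotProduct, betaPerpM, Fin.sum_univ_succ]

lemma betaPerpM_zero_of_ne {px qx : ℕ} (θ : Fin px → ℝ) (bx : Matrix (Fin px) (Fin qx) ℝ)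
    {j : Fin (qx + 1)} (hj : j ≠ 0) : betaPerpM θ bx 0 j = 0 := by
  obtain ⟨k, rfl⟩ := Fin.exists_succ_eq.mpr hj
  simp [betaPerpM]

lemma betaPerpM_of_ne {px qx : ℕ} (θ θ' : Fin px → ℝ) (bx : Matrix (Fin px) (Fin qx) ℝ)
    (i : Fin (px + 1)) {j : Fin (qx + 1)} (hj : j ≠ 0) :
    betaPerpM θ bx i j = betaPerpM θ' bx i j := by
  obtain ⟨k, rfl⟩ := Fin.exists_succ_eq.mpr hj
  refine Fin.cases ?_ (fun i => ?_) i <;> simp [betaPerpM]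

lemma mul_betaPerpM_of_ne {px qx : ℕ} (θ θ' : Fin px → ℝ) (bx : Matrix (Fin px) (Fin qx) ℝ)
    {Γ Γ' : Matrix (Fin (px + 1)) (Fin (px + 1)) ℝ} (hΓ : ∀ i j, j ≠ 0 → Γ i j = Γ' i j)
    (i : Fin (px + 1)) {j : Fin (qx + 1)} (hj : j ≠ 0) :
    (Γ * betaPerpM θ bx) i j = (Γ' * betaPerpM θ' bx) i j := by
  simp only [mul_apply]
  refine Finset.sum_congr rfl fun k _ => ?_
  by_cases hk : k = 0
  · simp [hk, betaPerpM_zero_of_ne _ _ hj]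
  · rw [hΓ i k hk, betaPerpM_of_ne θ θ' bx k hj]

/-- The two projections differ by a rank-one map that factors through the first coordinate
of the first projection. -/
lemma exists_Pproj_sub_eq_smul {px qx : ℕ} (αperp : Matrix (Fin (px + 1)) (Fin (qx + 1)) ℝ)
    (θ θ' : Fin px → ℝ) (bx : Matrix (Fin px) (Fin qx) ℝ)
    {Γ Γ' : Matrix (Fin (px + 1)) (Fin (px + 1)) ℝ} (hΓ : ∀ i j, j ≠ 0 → Γ i j = Γ' i j)
    (h : IsUnit (αperpᵀ * Γ * betaPerpM θ bx).det)
    (h' : IsUnit (αperpᵀ * Γ' * betaPerpM θ' bx).det) :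
    ∃ c : Fin (px + 1) → ℝ, ∀ u,
      Pproj αperp Γ (betaPerpM θ bx) *ᵥ u - Pproj αperp Γ' (betaPerpM θ' bx) *ᵥ u
        = (Pproj αperp Γ (betaPerpM θ bx) *ᵥ u) 0 • c := by
  set B := betaPerpM θ bx with hB
  set B' := betaPerpM θ' bx with hB'
  set A := αperpᵀ * Γ * B with hA
  set A' := αperpᵀ * Γ' * B' with hA'
  have hBcol : ∀ i j, j ≠ 0 → (B - B') i j = 0 := fun i j hj =>
    sub_eq_zero.mpr (betaPerpM_of_ne θ θ' bx i hj)
  have hAcol : ∀ i j, j ≠ 0 → (A - A') i j = 0 := fun i j hj => by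
    rw [hA, hA', Matrix.mul_assoc, Matrix.mul_assoc, Matrix.sub_apply, sub_eq_zero, mul_apply, mul_apply]
    exact Finset.sum_congr rfl fun k _ => by rw [hB, hB', mul_betaPerpM_of_ne θ θ' bx hΓ k hj]
  refine ⟨(fun i => (B - B') i 0) - (B' * A'⁻¹) *ᵥ fun i => (A - A') i 0, fun u => ?_⟩
  obtain ⟨w, hw⟩ : ∃ w, w = A⁻¹ *ᵥ (αperpᵀ *ᵥ u) := ⟨_, rfl⟩
  have hP : Pproj αperp Γ B *ᵥ u = B *ᵥ w := by
    simp only [hw, Pproj, mulVec_mulVec, Matrix.mul_assoc, hA]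
  have hu : αperpᵀ *ᵥ u = A *ᵥ w := by
    rw [hw, mulVec_mulVec, mul_nonsing_inv _ h, one_mulVec]
  have hP' : Pproj αperp Γ' B' *ᵥ u = (B' * A'⁻¹) *ᵥ (A *ᵥ w) := by
    rw [← hu, mulVec_mulVec, hA', Pproj]
  have hsplit : (B' * A'⁻¹) *ᵥ (A *ᵥ w) = B' *ᵥ w + (B' * A'⁻¹) *ᵥ ((A - A') *ᵥ w) := by
    rw [sub_mulVec, mulVec_sub, mulVec_mulVec w (B' * A'⁻¹) A', Matrix.mul_assoc B',
      nonsing_inv_mul _ h', Matrix.mul_one]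
    abel
  rw [hP', hP, hsplit, ← sub_sub, ← sub_mulVec, mulVec_eq_smul_col_zero _ hBcol,
    mulVec_eq_smul_col_zero _ hAcol, mulVec_smul, ← smul_sub, betaPerpM_zero_mulVec]

lemma toE_sub {ι : Type*} [Fintype ι] (v w : ι → ℝ) : toE (v - w) = toE v - toE w := rfl

lemma toE_smul {ι : Type*} [Fintype ι] (a : ℝ) (v : ι → ℝ) : toE (a • v) = a • toE v := rfl

lemma exists_norm_toE_mulVec_le {ι : Type*} [Fintype ι] [DecidableEq ι] (M : Matrix ι ι ℝ) :
    ∃ K, 0 ≤ K ∧ ∀ v, ‖toE (M *ᵥ v)‖ ≤ K * ‖toE v‖ :=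
  ⟨‖toEuclideanCLM (𝕜 := ℝ) M‖, norm_nonneg _, fun v =>
    (toEuclideanCLM (𝕜 := ℝ) M).le_opNorm (toE v)⟩

/-- kinked cointegration: Lipschitz continuity of `g(y,u) = P_{β_⊥}(y)u`
at the graph set `D_g = {(y,u) : y = h(y)ϑᵀu}`. -/
theorem kinked_lipschitz {px qx r : ℕ} (hpx : 1 ≤ px) (hq : qx ≤ px) (hr : r = px - qx)
    (α : Matrix (Fin (px + 1)) (Fin r) ℝ) (hα : α.rank = r)
    (αperp : Matrix (Fin (px + 1)) (Fin (qx + 1)) ℝ) (hαperp : αperp.rank = qx + 1)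
    (horth : αperpᵀ * α = 0)
    (θp θm : Fin px → ℝ) (bx : Matrix (Fin px) (Fin qx) ℝ) (hbx : bx.rank = qx)
    (Γp Γm : Matrix (Fin (px + 1)) (Fin (px + 1)) ℝ)
    (hΓ : ∀ i j, j ≠ 0 → Γp i j = Γm i j)
    (hdet : 0 < (αperpᵀ * Γp * betaPerpM θp bx).det * (αperpᵀ * Γm * betaPerpM θm bx).det)
    -- μ as in the representation e₁ᵀP_{β_⊥}(y) = h(y)ϑᵀ
    (μ : ℝ) (hμ : 0 < μ)
    (hrep : ∀ y : ℝ, ∀ j,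
      (if 0 ≤ y then Pproj αperp Γp (betaPerpM θp bx)
       else Pproj αperp Γm (betaPerpM θm bx)) 0 j
        = (if 0 ≤ y then 1 else μ) * Pproj αperp Γp (betaPerpM θp bx) 0 j) :
    ∃ C : ℝ, ∀ y : ℝ, ∀ u : Fin (px + 1) → ℝ,
      -- (y, u) ∈ D_g
      y = (if 0 ≤ y then 1 else μ) *
            ((fun j => Pproj αperp Γp (betaPerpM θp bx) 0 j) ⬝ᵥ u) →
      ∀ y' : ℝ, ∀ u' : Fin (px + 1) → ℝ,
        ‖toE ((if 0 ≤ y then Pproj αperp Γp (betaPerpM θp bx)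
               else Pproj αperp Γm (betaPerpM θm bx)).mulVec u)
          - toE ((if 0 ≤ y' then Pproj αperp Γp (betaPerpM θp bx)
                  else Pproj αperp Γm (betaPerpM θm bx)).mulVec u')‖
          ≤ C * (|y - y'| + ‖toE u - toE u'‖) := by
  obtain ⟨hdp, hdm⟩ := mul_ne_zero_iff.mp hdet.ne'
  obtain ⟨c, hc⟩ := exists_Pproj_sub_eq_smul αperp θp θm bx hΓ hdp.isUnit hdm.isUnit
  generalize Pproj αperp Γp (betaPerpM θp bx) = P at *
  generalize Pproj αperp Γm (betaPerpM θm bx) = Q at *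
  obtain ⟨K, hK, hPK⟩ := exists_norm_toE_mulVec_le P
  obtain ⟨L, hL, hQL⟩ := exists_norm_toE_mulVec_le Q
  have hc_norm : ∀ u, ‖toE (P *ᵥ u) - toE (Q *ᵥ u)‖ = |(P *ᵥ u) 0| * ‖toE c‖ := fun u => by
    rw [← toE_sub, hc, toE_smul, norm_smul, Real.norm_eq_abs]
  have hPd : ∀ u u', ‖toE (P *ᵥ u) - toE (P *ᵥ u')‖ ≤ K * ‖toE u - toE u'‖ := fun u u' => by
    simpa only [← toE_sub, ← mulVec_sub] using hPK (u - u')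
  have hQd : ∀ u u', ‖toE (Q *ᵥ u) - toE (Q *ᵥ u')‖ ≤ L * ‖toE u - toE u'‖ := fun u u' => by
    simpa only [← toE_sub, ← mulVec_sub] using hQL (u - u')
  have hμc : 0 ≤ μ⁻¹ * ‖toE c‖ := by positivity
  refine ⟨K + L + ‖toE c‖ + μ⁻¹ * ‖toE c‖, fun y u hy y' u' => ?_⟩
  have hy_coord : y = (if 0 ≤ y then 1 else μ) * (P *ᵥ u) 0 := hy
  have hd := norm_nonneg (toE u - toE u')
  have hdy := abs_nonneg (y - y')
  have hcn := norm_nonneg (toE c)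
  have hKd := mul_nonneg hK hdy
  have hLd := mul_nonneg hL hdy
  have hKu := mul_nonneg hK hd
  have hLu := mul_nonneg hL hd
  have hcd := mul_nonneg hcn hdy
  have hcu := mul_nonneg hcn hd
  have hμd := mul_nonneg hμc hdy
  have hμu := mul_nonneg hμc hd
  rcases le_or_gt 0 y with h | h <;> rcases le_or_gt 0 y' with h' | h'
  · simp only [if_pos h, if_pos h']
    linarith [hPd u u']
  · simp only [if_pos h, if_neg h'.not_ge]
    rw [if_pos h, one_mul] at hy_coord
    have hle : |(P *ᵥ u) 0| ≤ |y - y'| := by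
      rw [← hy_coord, abs_of_nonneg h, abs_of_pos (by linarith)]
      linarith
    have htri := norm_sub_le_norm_sub_add_norm_sub (toE (P *ᵥ u)) (toE (Q *ᵥ u)) (toE (Q *ᵥ u'))
    linarith [hQd u u', hc_norm u, mul_le_mul_of_nonneg_right hle hcn]
  · simp only [if_neg h.not_ge, if_pos h']
    rw [if_neg h.not_ge] at hy_coord
    have hle : |(P *ᵥ u) 0| ≤ μ⁻¹ * |y - y'| := by
      have habs : μ * |(P *ᵥ u) 0| = |μ * (P *ᵥ u) 0| := by rw [abs_mul, abs_of_pos hμ]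
      rw [le_inv_mul_iff₀ hμ, habs, ← hy_coord,
        abs_of_neg h, abs_of_neg (by linarith)]
      linarith
    have htri := norm_sub_le_norm_sub_add_norm_sub (toE (Q *ᵥ u)) (toE (P *ᵥ u)) (toE (P *ᵥ u'))
    rw [norm_sub_rev (toE (Q *ᵥ u)) (toE (P *ᵥ u)), hc_norm u] at htri
    linarith [hPd u u', mul_le_mul_of_nonneg_right hle hcn]
  · simp only [if_neg h.not_ge, if_neg h'.not_ge]
    linarith [hQd u u']

end Kinked
end

section
/- Let α, β ∈ ℝ^{m×s} and α_⊥, β_⊥ ∈ ℝ^{m×(m−s)} all have full column rank, with α_⊥ᵀα = 0, β_⊥ᵀβ = 0, and suppose the s×s matrix βᵀα and the (m−s)×(m−s) matrix α_⊥ᵀβ_⊥ are invertible. Let c ∈ ℝ^m satisfy α_⊥ᵀc = 0, let w₀ ∈ ℝ^m and v_t ∈ ℝ^m (t ≥ 1) be arbitrary, and define w_t := w_{t−1} + c + αβᵀw_{t−1} + v_t for t ≥ 1. Then with P_{β_⊥} := β_⊥(α_⊥ᵀβ_⊥)^{-1}α_⊥ᵀ, for every t ≥ 1: w_t = P_{β_⊥}·(w₀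 + Σ_{s=1}^t v_s) + α(βᵀα)^{-1}βᵀw_t. (In particular, the common-trend component of w_t is the projection P_{β_⊥} of the cumulated innovations plus initial condition, and the remainder is a linear function of the equilibrium error βᵀw_t.) -/
open Matrix Finset

/-- If `Aᵀ C = 0` and `Dᵀ B = 0` with `Aᵀ B` and `Dᵀ C` invertible, and the numbers of columns add
up to the dimension, then the oblique projections `B (Aᵀ B)⁻¹ Aᵀ` and `C (Dᵀ C)⁻¹ Dᵀ` are
complementary. -/
theorem Matrix.oblique_projections_add_eq_one {n p q R : Type*} [CommRing R]
    [Fintype n] [DecidableEq n] [Fintype p] [DecidableEq p] [Fintype q] [DecidableEq q]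
    (hcard : Fintype.card n = Fintype.card p + Fintype.card q)
    {A B : Matrix n p R} {C D : Matrix n q R}
    (hAC : Aᵀ * C = 0) (hDB : Dᵀ * B = 0)
    (hAB : IsUnit (Aᵀ * B)) (hDC : IsUnit (Dᵀ * C)) :
    B * (Aᵀ * B)⁻¹ * Aᵀ + C * (Dᵀ * C)⁻¹ * Dᵀ = 1 := by
  have hLR : fromRows Aᵀ Dᵀ * fromCols (B * (Aᵀ * B)⁻¹) (C * (Dᵀ * C)⁻¹) = 1 := by
    rw [fromRows_mul_fromCols, ← Matrix.mul_assoc, ← Matrix.mul_assoc, ← Matrix.mul_assoc,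
      ← Matrix.mul_assoc, hAC, hDB, Matrix.zero_mul, Matrix.zero_mul,
      mul_nonsing_inv _ ((isUnit_iff_isUnit_det _).1 hAB),
      mul_nonsing_inv _ ((isUnit_iff_isUnit_det _).1 hDC), fromBlocks_one]
  rw [← fromCols_mul_fromRows]
  exact (mul_eq_one_comm_of_card_eq _ _ _ (by simpa using hcard.symm)).1 hLR

/-- A covector matrix `A` annihilating the drift and the loadings sees a vector error correction
process as the initial condition plus the cumulated innovations. -/
theorem Matrix.mulVec_vecm_eq {n p q R : Type*} [CommRing R] [Fintype n] [Fintype q]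
    {A : Matrix p n R} {B : Matrix n q R} {D : Matrix q n R} (hAB : A * B = 0)
    {c : n → R} (hc : A *ᵥ c = 0) {v w : ℕ → n → R}
    (hw : ∀ t : ℕ, 1 ≤ t → w t = w (t - 1) + c + (B * D) *ᵥ w (t - 1) + v t) (t : ℕ) :
    A *ᵥ w t = A *ᵥ (w 0 + ∑ i ∈ Finset.Icc 1 t, v i) := by
  induction t with
  | zero => simp
  | succ t ih =>
    rw [hw (t + 1) (by lia), Finset.sum_Icc_succ_top (by lia), ← add_assoc, mulVec_add,
      mulVec_add _ (w 0 + _), ← ih, add_tsub_cancel_right, mulVec_add, mulVec_add, hc,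
      mulVec_mulVec, ← Matrix.mul_assoc, hAB, Matrix.zero_mul, zero_mulVec, add_zero, add_zero]

/-- common trends decomposition in a linear VECM.
Let `α, β ∈ ℝ^{m×s}` and `α_⊥, β_⊥ ∈ ℝ^{m×(m−s)}` have full column rank, with
`α_⊥ᵀα = 0`, `β_⊥ᵀβ = 0`, and `βᵀα` and `α_⊥ᵀβ_⊥` invertible.  If `α_⊥ᵀc = 0` and
`w_t = w_{t−1} + c + αβᵀw_{t−1} + v_t` for `t ≥ 1`, then with
`P_{β_⊥} := β_⊥(α_⊥ᵀβ_⊥)⁻¹α_⊥ᵀ`, for every `t ≥ 1`: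
`w_t = P_{β_⊥}(w₀ + Σ_{i=1}^t v_i) + α(βᵀα)⁻¹βᵀ w_t`. -/
theorem common_trends_projection {m s : ℕ} (hs : s < m)
    (α β : Matrix (Fin m) (Fin s) ℝ)
    (αperp βperp : Matrix (Fin m) (Fin (m - s)) ℝ)
    (hα : α.rank = s) (hβ : β.rank = s)
    (hαperp : αperp.rank = m - s) (hβperp : βperp.rank = m - s)
    (hoα : αperpᵀ * α = 0) (hoβ : βperpᵀ * β = 0)
    (hba : IsUnit (βᵀ * α)) (hab : IsUnit (αperpᵀ * βperp))
    (c : Fin m → ℝ) (hc : αperpᵀ.mulVec c = 0)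
    (w₀ : Fin m → ℝ) (v : ℕ → Fin m → ℝ) (w : ℕ → Fin m → ℝ)
    (hw0 : w 0 = w₀)
    (hw : ∀ t : ℕ, 1 ≤ t →
      w t = w (t - 1) + c + (α * βᵀ).mulVec (w (t - 1)) + v t) :
    ∀ t : ℕ, 1 ≤ t →
      w t = (βperp * (αperpᵀ * βperp)⁻¹ * αperpᵀ).mulVec (w₀ + ∑ i ∈ Finset.Icc 1 t, v i)
        + (α * (βᵀ * α)⁻¹ * βᵀ).mulVec (w t) := by
  intro t _
  have hβperpβ : βᵀ * βperp = 0 := by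
    simpa using congrArg transpose hoβ
  have hproj := oblique_projections_add_eq_one (by simp; lia) hoα hβperpβ hab hba
  rw [← hw0, ← mulVec_mulVec, ← mulVec_vecm_eq hoα hc hw t, mulVec_mulVec, ← add_mulVec, hproj,
    one_mulVec]
end
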